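/- For k ≥ 2 and α ∈ ℝᵏ with αⱼ > 0 for all j, the Dirichlet normalization constant satisfies ∫_{Δ} (∏_{j=1}^{k−1} xⱼ^{αⱼ − 1}) · (1 − Σ_{j=1}^{k−1} xⱼ)^{α_k − 1} dx = (∏_{j=1}^{k} Γ(αⱼ)) / Γ(Σ_{j=1}^{k} αⱼ), where the integral is over the open set Δ = {x ∈ ℝ^{k−1} : xⱼ > 0 for all j and Σ_{j=1}^{k−1} xⱼ < 1} with respect to (k−1)-dimensional Lebesgue measure, and Γ denotes the Gamma function Γ(s) = ∫₀^∞ x^{s−1} e^{−x} dx. -/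

import Mathlib

open MeasureTheory

open scoped ENNReal in
/-- The power `t ^ (a - 1)` on the positive half-line, extended by zero. -/
noncomputable def posPow (a t : ℝ) : ℝ≥0∞ :=
  if 0 < t then ENNReal.ofReal (t ^ (a - 1)) else 0

lemma posPow_of_pos {a t : ℝ} (ht : 0 < t) : posPow a t = ENNReal.ofReal (t ^ (a - 1)) :=
  if_pos ht

lemma posPow_of_nonpos {a t : ℝ} (ht : t ≤ 0) : posPow a t = 0 :=
  if_neg ht.not_gt

lemma posPow_ne_top (a t : ℝ) : posPow a t ≠ ⊤ := by
  unfold posPow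
  split_ifs <;> simp

@[fun_prop]
lemma measurable_posPow (a : ℝ) : Measurable (posPow a) := by
  unfold posPow
  exact Measurable.ite measurableSet_Ioi (by fun_prop) measurable_const

lemma posPow_mul {s : ℝ} (hs : 0 < s) (a t : ℝ) :
    posPow a (s * t) = ENNReal.ofReal (s ^ (a - 1)) * posPow a t := by
  by_cases ht : 0 < t
  · rw [posPow_of_pos ht, posPow_of_pos (mul_pos hs ht), Real.mul_rpow hs.le ht.le,
      ENNReal.ofReal_mul (by positivity)]
  · rw [posPow_of_nonpos (not_lt.1 ht), mul_zero,
      posPow_of_nonpos (mul_nonpos_of_nonneg_of_nonpos hs.le (not_lt.1 ht))]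

lemma posPow_mul_posPow_one_sub {a b : ℝ} (ha : 0 < a) (hb : 0 < b) (u : ℝ) :
    posPow a u * posPow b (1 - u) =
      ENNReal.ofReal (ProbabilityTheory.beta a b) * ProbabilityTheory.betaPDF a b u := by
  rcases le_or_gt u 0 with h0 | h0
  · rw [posPow_of_nonpos h0, ProbabilityTheory.betaPDF_eq_zero_of_nonpos h0, zero_mul, mul_zero]
  rcases le_or_gt 1 u with h1 | h1
  · rw [posPow_of_nonpos (sub_nonpos.2 h1), ProbabilityTheory.betaPDF_eq_zero_of_one_le h1,
      mul_zero, mul_zero]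
  have h1' : 0 < 1 - u := sub_pos.2 h1
  have hB := ProbabilityTheory.beta_pos ha hb
  rw [posPow_of_pos h0, posPow_of_pos h1', ProbabilityTheory.betaPDF_of_pos_lt_one h0 h1,
    ← ENNReal.ofReal_mul (by positivity), ← ENNReal.ofReal_mul hB.le]
  congr 1
  field_simp

/-- The convolution of two power functions on the half-line is again a power function. -/
lemma lintegral_posPow_mul_posPow_sub {a b : ℝ} (ha : 0 < a) (hb : 0 < b) (s : ℝ) :
    ∫⁻ x, posPow a x * posPow b (s - x) =
      ENNReal.ofReal (ProbabilityTheory.beta a b) * posPow (a + b) s := by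
  rcases le_or_gt s 0 with hs | hs
  · rw [posPow_of_nonpos hs, mul_zero]
    refine (lintegral_congr fun x => ?_).trans lintegral_zero
    rcases le_or_gt x 0 with hx | hx
    · rw [posPow_of_nonpos hx, zero_mul]
    · rw [posPow_of_nonpos (a := b) (by linarith), mul_zero]
  have hscale : ∀ u, posPow a (s * u) * posPow b (s - s * u) =
      ENNReal.ofReal (s ^ (a - 1) * s ^ (b - 1) * ProbabilityTheory.beta a b) *
        ProbabilityTheory.betaPDF a b u := by
    intro u
    rw [show s - s * u = s * (1 - u) by ring, posPow_mul hs, posPow_mul hs, mul_mul_mul_comm,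
      posPow_mul_posPow_one_sub ha hb, ENNReal.ofReal_mul (by positivity),
      ENNReal.ofReal_mul (by positivity), mul_assoc, mul_assoc, mul_assoc]
  rw [← Real.smul_map_volume_mul_left hs.ne', lintegral_smul_measure,
    lintegral_map (by fun_prop) (by fun_prop)]
  simp_rw [hscale]
  rw [lintegral_const_mul' _ _ ENNReal.ofReal_ne_top,
    ProbabilityTheory.lintegral_betaPDF_eq_one ha hb, mul_one, posPow_of_pos hs, smul_eq_mul,
    ← ENNReal.ofReal_mul (abs_nonneg _), ← ENNReal.ofReal_mul (ProbabilityTheory.beta_pos ha hb).le,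
    abs_of_pos hs]
  congr 1
  have hpow : s ^ (a + b - 1) = s * s ^ (a - 1) * s ^ (b - 1) := by
    nth_rw 2 [← Real.rpow_one s]
    rw [← Real.rpow_add hs, ← Real.rpow_add hs]
    ring_nf
  rw [hpow]
  ring

lemma lintegral_prod_posPow_mul_posPow_sub_sum {b : ℝ} (hb : 0 < b) :
    ∀ (m : ℕ) (α : Fin m → ℝ) (_ : ∀ j, 0 < α j) (s : ℝ),
      ∫⁻ x : Fin m → ℝ, (∏ j, posPow (α j) (x j)) * posPow b (s - ∑ j, x j) =
        ENNReal.ofReal ((∏ j, Real.Gamma (α j)) * Real.Gamma b / Real.Gamma (∑ j, α j + b)) *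
          posPow (∑ j, α j + b) s
  | 0, α, _, s => by
    simp [lintegral_unique, volume_pi, div_self (Real.Gamma_pos_of_pos hb).ne']
  | m + 1, α, hα, s => by
    have hα' : ∀ j : Fin m, 0 < α j.succ := fun j => hα j.succ
    have hsum : 0 < ∑ j : Fin m, α j.succ + b :=
      add_pos_of_nonneg_of_pos (Finset.sum_nonneg fun j _ => (hα' j).le) hb
    have hΓ := Real.Gamma_pos_of_pos hsum
    rw [← ((volume_preserving_piFinSuccAbove (fun _ : Fin (m + 1) => ℝ) 0).symm).lintegral_comp
      (by fun_prop), Measure.volume_eq_prod, lintegral_prod _ (by fun_prop)]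
    simp only [MeasurableEquiv.piFinSuccAbove_symm_apply, Fin.insertNthEquiv_apply,
      Fin.insertNth_zero', Fin.prod_univ_succ, Fin.sum_univ_succ, Fin.cons_zero, Fin.cons_succ,
      ← sub_sub, mul_assoc]
    simp_rw [lintegral_const_mul' _ _ (posPow_ne_top _ _),
      lintegral_prod_posPow_mul_posPow_sub_sum hb m (fun j => α j.succ) hα',
      mul_left_comm (posPow _ _)]
    rw [lintegral_const_mul' _ _ ENNReal.ofReal_ne_top,
      lintegral_posPow_mul_posPow_sub (hα 0) hsum, ← mul_assoc, add_assoc,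
      ← ENNReal.ofReal_mul]
    · congr 2
      rw [ProbabilityTheory.beta]
      field_simp
    · have := Real.Gamma_pos_of_pos hb
      have := Finset.prod_nonneg fun j (_ : j ∈ Finset.univ) =>
        (Real.Gamma_pos_of_pos (hα' j)).le
      positivity

/-- the Dirichlet normalization constant.  For `k = m + 1 ≥ 2` and
`α ∈ ℝᵏ` with all entries positive,
`∫_Δ (∏_{j<k} xⱼ^(αⱼ−1)) (1 − ∑_{j<k} xⱼ)^(α_k−1) dx = (∏ⱼ Γ(αⱼ)) / Γ(∑ⱼ αⱼ)`,
where `Δ = {x ∈ ℝ^{k−1} : xⱼ > 0, ∑ xⱼ < 1}` carries `(k−1)`-dimensional Lebesgue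
measure and `Γ` is the Gamma function. -/
theorem dirichlet_normalization_constant
    (m : ℕ) (hm : 1 ≤ m) (α : Fin (m + 1) → ℝ) (hα : ∀ j, 0 < α j) :
    (∫ x : Fin m → ℝ in {x | (∀ j, 0 < x j) ∧ ∑ j, x j < 1},
        (∏ j : Fin m, x j ^ (α j.castSucc - 1)) *
          (1 - ∑ j, x j) ^ (α (Fin.last m) - 1)) =
      (∏ j, Real.Gamma (α j)) / Real.Gamma (∑ j, α j) := by
  have hmeas : MeasurableSet {x : Fin m → ℝ | (∀ j, 0 < x j) ∧ ∑ j, x j < 1} := by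
    measurability
  have hΓ : 0 ≤ (∏ j, Real.Gamma (α j)) / Real.Gamma (∑ j, α j) :=
    div_nonneg (Finset.prod_nonneg fun j _ => (Real.Gamma_pos_of_pos (hα j)).le)
      (Real.Gamma_nonneg_of_nonneg (Finset.sum_nonneg fun j _ => (hα j).le))
  rw [integral_eq_lintegral_of_nonneg_ae, ← lintegral_indicator hmeas]
  · have hind : ∀ x : Fin m → ℝ,
        Set.indicator {x : Fin m → ℝ | (∀ j, 0 < x j) ∧ ∑ j, x j < 1}
          (fun x => ENNReal.ofReal ((∏ j : Fin m, x j ^ (α j.castSucc - 1)) *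
            (1 - ∑ j, x j) ^ (α (Fin.last m) - 1))) x =
          (∏ j : Fin m, posPow (α j.castSucc) (x j)) *
            posPow (α (Fin.last m)) (1 - ∑ j, x j) := by
      intro x
      by_cases hx : (∀ j, 0 < x j) ∧ ∑ j, x j < 1
      · have hpow : ∀ j, 0 ≤ x j ^ (α j.castSucc - 1) := fun j => Real.rpow_nonneg (hx.1 j).le _
        rw [Set.indicator_of_mem (by exact hx), posPow_of_pos (sub_pos.2 hx.2),
          ENNReal.ofReal_mul (Finset.prod_nonneg fun j _ => hpow j),
          ENNReal.ofReal_prod_of_nonneg fun j _ => hpow j]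
        simp_rw [posPow_of_pos (hx.1 _)]
      · rw [Set.indicator_of_notMem (by exact hx)]
        by_cases h : ∀ j, 0 < x j
        · rw [posPow_of_nonpos (sub_nonpos.2 (not_lt.1 fun h' => hx ⟨h, h'⟩)), mul_zero]
        · push Not at h
          obtain ⟨j, hj⟩ := h
          rw [Finset.prod_eq_zero (Finset.mem_univ j) (posPow_of_nonpos hj), zero_mul]
    simp_rw [hind]
    rw [lintegral_prod_posPow_mul_posPow_sub_sum (hα _) m _ (fun j => hα _),
      ← Fin.prod_univ_castSucc (fun j => Real.Gamma (α j)), ← Fin.sum_univ_castSucc,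
      posPow_of_pos one_pos, Real.one_rpow, ENNReal.ofReal_one, mul_one, ENNReal.toReal_ofReal hΓ]
  · filter_upwards [ae_restrict_mem hmeas] with x hx
    exact mul_nonneg (Finset.prod_nonneg fun j _ => Real.rpow_nonneg (hx.1 j).le _)
      (Real.rpow_nonneg (sub_nonneg.2 hx.2.le) _)
  · exact Measurable.aestronglyMeasurable (by fun_prop)
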